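/- Let M be an S5 epistemic model based on a finite frame, let M^r be the M-reduced classical S5 model, and let w be a maximal world of M. Then for every formula φ of L_ICK: M, w ⊨ τ(φ) if and only if M^r, w ⊨_c φ. -/

import Mathlib

namespace ICK

/-- Formulae of the language `L_ICK` over a type of agents and natural-number atoms. -/
inductive Formula (Agent : Type) : Type
  | bot : Formula Agent
  | atom : ℕ → Formula Agent
  | and : Formula Agent → Formula Agent → Formula Agent
  | or : Formula Agent → Formula Agent → Formula Agent
  | imp : Formula Agent → Formula Agent → Formula Agent
  | know : Agent → Formula Agent → Formula Agent
  | ck : Formula Agent → Formula Agent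

namespace Formula

variable {Agent : Type}

/-- `¬φ := φ → ⊥`. -/
def neg (φ : Formula Agent) : Formula Agent := φ.imp Formula.bot

/-- `⊤ := ⊥ → ⊥`. -/
def top : Formula Agent := Formula.imp Formula.bot Formula.bot

/-- `φ ↔ ψ := (φ → ψ) ∧ (ψ → φ)`. -/
def biimp (φ ψ : Formula Agent) : Formula Agent := (φ.imp ψ).and (ψ.imp φ)

end Formula

/-- The formula `E φ = ⋀_{a ∈ A} K_a φ` (everybody knows). -/
noncomputable def Efml {Agent : Type} [Fintype Agent] (φ : Formula Agent) : Formula Agent :=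
  (Finset.univ : Finset Agent).toList.foldr (fun a ψ => (Formula.know a φ).and ψ) Formula.top

/-- A birelational epistemic model: a poset `(W, ≤)` with triangle-confluent
modal relations `R a` and a `≤`-monotone valuation. -/
structure Model (Agent W : Type) where
  le : W → W → Prop
  R : Agent → W → W → Prop
  V : W → ℕ → Prop
  le_refl : ∀ w, le w w
  le_trans : ∀ w v u, le w v → le v u → le w u
  le_antisymm : ∀ w v, le w v → le v w → w = v
  tri : ∀ a w v u, le w v → R a v u → R a w u
  mono : ∀ w v, le w v → ∀ n, V w n → V v n

/-- The union `R = ⋃_a R_a`. -/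
def Model.Step {Agent W : Type} (M : Model Agent W) (w v : W) : Prop := ∃ a, M.R a w v

/-- Intuitionistic truth in an epistemic model. -/
def Sat {Agent W : Type} (M : Model Agent W) : Formula Agent → W → Prop
  | .bot, _ => False
  | .atom n, w => M.V w n
  | .and φ ψ, w => Sat M φ w ∧ Sat M ψ w
  | .or φ ψ, w => Sat M φ w ∨ Sat M ψ w
  | .imp φ ψ, w => ∀ v, M.le w v → Sat M φ v → Sat M ψ v
  | .know a φ, w => ∀ v, M.R a w v → Sat M φ v
  | .ck φ, w => ∀ v, Relation.ReflTransGen M.Step w v → Sat M φ v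

def Model.IsRefl {Agent W : Type} (M : Model Agent W) : Prop := ∀ a w, M.R a w w

def Model.IsTrans {Agent W : Type} (M : Model Agent W) : Prop :=
  ∀ a w v u, M.R a w v → M.R a v u → M.R a w u

def Model.IsSymm {Agent W : Type} (M : Model Agent W) : Prop :=
  ∀ a w v, M.R a w v → M.R a v w

def Model.IsS4 {Agent W : Type} (M : Model Agent W) : Prop := M.IsRefl ∧ M.IsTrans

def Model.IsS5 {Agent W : Type} (M : Model Agent W) : Prop := M.IsS4 ∧ M.IsSymm

/-- Validity over the class of all epistemic frames. -/
def ValidAll (Agent : Type) (φ : Formula Agent) : Prop :=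
  ∀ (W : Type) (M : Model Agent W) (w : W), Sat M φ w

/-- Validity over the class of reflexive epistemic frames. -/
def ValidRefl (Agent : Type) (φ : Formula Agent) : Prop :=
  ∀ (W : Type) (M : Model Agent W), M.IsRefl → ∀ w : W, Sat M φ w

/-- Validity over the class of S4 epistemic frames. -/
def ValidS4 (Agent : Type) (φ : Formula Agent) : Prop :=
  ∀ (W : Type) (M : Model Agent W), M.IsS4 → ∀ w : W, Sat M φ w

/-- Validity over the class of S5 epistemic frames. -/
def ValidS5 (Agent : Type) (φ : Formula Agent) : Prop :=
  ∀ (W : Type) (M : Model Agent W), M.IsS5 → ∀ w : W, Sat M φ w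

/-- A classical S5 model. -/
structure CModel (Agent W : Type) where
  R : Agent → W → W → Prop
  V : W → ℕ → Prop
  equiv : ∀ a, Equivalence (R a)

def CModel.Step {Agent W : Type} (M : CModel Agent W) (w v : W) : Prop := ∃ a, M.R a w v

/-- Classical truth in a classical S5 model. -/
def CSat {Agent W : Type} (M : CModel Agent W) : Formula Agent → W → Prop
  | .bot, _ => False
  | .atom n, w => M.V w n
  | .and φ ψ, w => CSat M φ w ∧ CSat M ψ w
  | .or φ ψ, w => CSat M φ w ∨ CSat M ψ w
  | .imp φ ψ, w => CSat M φ w → CSat M ψ w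
  | .know a φ, w => ∀ v, M.R a w v → CSat M φ v
  | .ck φ, w => ∀ v, Relation.ReflTransGen M.Step w v → CSat M φ v

/-- `CKS5`: truth at every world of every classical S5 model. -/
def CKS5 (Agent : Type) (φ : Formula Agent) : Prop :=
  ∀ (W : Type) (M : CModel Agent W) (w : W), CSat M φ w

/-- The auxiliary Kuroda-style map `τ`. -/
def tau {Agent : Type} : Formula Agent → Formula Agent
  | .bot => Formula.bot
  | .atom n => Formula.atom n
  | .and φ ψ => (tau φ).and (tau ψ)
  | .or φ ψ => (tau φ).or (tau ψ)
  | .imp φ ψ => (tau φ).imp (tau ψ)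
  | .know a φ => Formula.know a ((tau φ).neg.neg)
  | .ck φ => Formula.ck ((tau φ).neg.neg)

/-- The Kuroda translation `tr(φ) := ¬¬τ(φ)`. -/
def tr {Agent : Type} (φ : Formula Agent) : Formula Agent := (tau φ).neg.neg

/-- Maximal worlds of an epistemic model. -/
def MaxWorld {Agent W : Type} (M : Model Agent W) : Type :=
  {w : W // ∀ v, M.le w v → w = v}

/-- The reduced classical S5 model of an S5 epistemic model:
the restriction to maximal worlds. -/
def reduced {Agent W : Type} (M : Model Agent W) (h5 : M.IsS5) :
    CModel Agent (MaxWorld M) where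
  R a x y := M.R a x.1 y.1
  V x n := M.V x.1 n
  equiv a :=
    ⟨fun x => h5.1.1 a x.1,
     fun {x y} h => h5.2 a x.1 y.1 h,
     fun {x y z} h h' => h5.1.2 a x.1 y.1 z.1 h h'⟩

theorem Model.exists_maxWorld_ge {Agent W : Type} [Finite W] (M : Model Agent W) (w : W) :
    ∃ x : MaxWorld M, M.le w x.1 := by
  let _ : PartialOrder W :=
    { le := M.le
      le_refl := M.le_refl
      le_trans := M.le_trans
      le_antisymm := M.le_antisymm }
  obtain ⟨x, hwx, hx⟩ := Finite.exists_le_maximal (p := fun _ : W => True) (a := w) trivial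
  exact ⟨⟨x, fun v hv => M.le_antisymm x v hv (hx.2 trivial hv)⟩, hwx⟩

/-- In a reflexive model, the order is contained in every modal relation. -/
theorem Model.IsRefl.rel_of_le {Agent W : Type} {M : Model Agent W} (h : M.IsRefl)
    (a : Agent) {w v : W} (hwv : M.le w v) : M.R a w v :=
  M.tri a w v v hwv (h a v)

/-- In a finite model, a double negation holds iff the formula holds at all maximal
worlds above. -/
theorem sat_neg_neg_iff {Agent W : Type} [Finite W] (M : Model Agent W)
    (φ : Formula Agent) (w : W) :
    Sat M φ.neg.neg w ↔ ∀ x : MaxWorld M, M.le w x.1 → Sat M φ x.1 := by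
  constructor
  · intro h x hx
    by_contra hφ
    exact h x.1 hx fun v hv hv' => hφ (by rwa [x.2 v hv])
  · intro h u hu hn
    obtain ⟨x, hx⟩ := M.exists_maxWorld_ge u
    exact hn x.1 hx (h x (M.le_trans _ _ _ hu hx))

/-- A path from a maximal world lifts to a path of maximal worlds, ending at any
maximal world above its endpoint. -/
theorem reduced_reachable_of_reachable {Agent W : Type} [Finite W] (M : Model Agent W)
    (h5 : M.IsS5) (w : MaxWorld M) {v : W} (h : Relation.ReflTransGen M.Step w.1 v) :
    ∀ x : MaxWorld M, M.le v x.1 → Relation.ReflTransGen (reduced M h5).Step w x := by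
  induction h with
  | refl =>
    intro x hx
    rw [Subtype.ext (w.2 x.1 hx)]
  | @tail b c _ hbc ih =>
    intro x hx
    obtain ⟨y, hy⟩ := M.exists_maxWorld_ge b
    obtain ⟨a, ha⟩ := hbc
    have hyb : M.R a y.1 b := h5.2 a _ _ (h5.1.1.rel_of_le a hy)
    have hyc : M.R a y.1 c := h5.1.2 a _ _ _ hyb ha
    exact (ih y hy).tail ⟨a, h5.1.2 a _ _ _ hyc (h5.1.1.rel_of_le a hx)⟩

theorem reachable_of_reduced_reachable {Agent W : Type} (M : Model Agent W)
    (h5 : M.IsS5) {w x : MaxWorld M}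
    (h : Relation.ReflTransGen (reduced M h5).Step w x) :
    Relation.ReflTransGen M.Step w.1 x.1 :=
  Relation.ReflTransGen.lift (p := M.Step) Subtype.val (fun _ _ hab => hab) w x h

/-- For a finite S5 epistemic model and a maximal world `w`:
`M, w ⊨ τ(φ)` iff `M^r, w ⊨_c φ`. -/
theorem reduced_model_truth (Agent : Type) [Fintype Agent] [Nonempty Agent]
    (W : Type) [Finite W] (M : Model Agent W) (h5 : M.IsS5)
    (w : MaxWorld M) (φ : Formula Agent) :
    Sat M (tau φ) w.1 ↔ CSat (reduced M h5) φ w := by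
  induction φ generalizing w with
  | bot => exact Iff.rfl
  | atom n => exact Iff.rfl
  | and φ ψ ihφ ihψ => exact and_congr (ihφ w) (ihψ w)
  | or φ ψ ihφ ihψ => exact or_congr (ihφ w) (ihψ w)
  | imp φ ψ ihφ ihψ =>
    constructor
    · intro h hφ
      exact (ihψ w).1 (h w.1 (M.le_refl _) ((ihφ w).2 hφ))
    · intro h v hv hφ
      obtain rfl := w.2 v hv
      exact (ihψ w).2 (h ((ihφ w).1 hφ))
  | know a φ ih =>
    constructor
    · intro h x hx
      exact (ih x).1 ((sat_neg_neg_iff M _ _).1 (h x.1 hx) x (M.le_refl _))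
    · intro h v hv
      refine (sat_neg_neg_iff M _ _).2 fun x hx => (ih x).2 (h x ?_)
      exact h5.1.2 a _ _ _ hv (h5.1.1.rel_of_le a hx)
  | ck φ ih =>
    constructor
    · intro h x hx
      exact (ih x).1 ((sat_neg_neg_iff M _ _).1
        (h x.1 (reachable_of_reduced_reachable M h5 hx)) x (M.le_refl _))
    · intro h v hv
      exact (sat_neg_neg_iff M _ _).2 fun x hx =>
        (ih x).2 (h x (reduced_reachable_of_reachable M h5 w hv x hx))

end ICK
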